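/- Let A = k × k with comultiplication making it a bialgebra via Δ(e) = e⊗e (hence Δ(f) = 1⊗1 − e⊗e, where e, f are the nontrivial idempotents). Then there is a unique dg bialgebra structure on the dg algebra Ω(A) of noncommutative differential forms on A extending this comultiplication, i.e., Δ extends to a coassociative dg algebra map Δ: Ω(A) → Ω(A) ⊗ Ω(A). Moreover the two-sided ideal generated by e(de) is a coideal, so the quotient Ω(A)/(e de) inherits a dg bialgebra structure. -/

import Mathlib

open TensorProduct

def gsign (k : Type) [Field k] (i : ℤ) : k := if Even i then 1 else -1

/-- A dg algebra over `k`, bundled. -/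
structure DGAlg (k : Type) [Field k] where
  carrier : Type
  [ringInst : Ring carrier]
  [algInst : Algebra k carrier]
  grading : ℤ → Submodule k carrier
  one_mem : (1 : carrier) ∈ grading 0
  mul_mem : ∀ i j (a b : carrier), a ∈ grading i → b ∈ grading j → a * b ∈ grading (i + j)
  d : carrier →ₗ[k] carrier
  d_mem : ∀ i (a : carrier), a ∈ grading i → d a ∈ grading (i + 1)
  leibniz : ∀ i (a b : carrier), a ∈ grading i →
    d (a * b) = d a * b + (if Even i then (1 : k) else -1) • (a * d b)
  d_sq : ∀ a : carrier, d (d a) = 0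

attribute [instance] DGAlg.ringInst DGAlg.algInst

theorem gsign_zero (k : Type) [Field k] : gsign k 0 = 1 := by simp [gsign]

theorem gsign_add (k : Type) [Field k] (i j : ℤ) :
    gsign k (i + j) = gsign k i * gsign k j := by
  simp only [gsign, Int.even_add]
  by_cases hi : Even i <;> by_cases hj : Even j <;> simp [hi, hj]

theorem gsign_one (k : Type) [Field k] : gsign k 1 = -1 := by simp [gsign]

theorem gsign_mul_self (k : Type) [Field k] (i : ℤ) : gsign k i * gsign k i = 1 := by
  unfold gsign
  split_ifs <;> simp

/-- The dg algebra of endomorphisms of a `ℤ/2`-graded complex with differential `D` and parity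
operator `S`. -/
def endDGAlg {k : Type} [Field k] {V : Type} [AddCommGroup V] [Module k V]
    (D S : Module.End k V) (hSS : S * S = 1) (hSD : S * D = -(D * S)) (hDD : D * D = 0) :
    DGAlg k where
  carrier := Module.End k V
  grading i := LinearMap.ker
    (LinearMap.mulLeft k S ∘ₗ LinearMap.mulRight k S - gsign k i • LinearMap.id)
  one_mem := by simp [gsign_zero, hSS]
  mul_mem i j a b ha hb := by
    simp only [LinearMap.mem_ker, LinearMap.sub_apply, LinearMap.comp_apply,
      LinearMap.mulLeft_apply, LinearMap.mulRight_apply, LinearMap.smul_apply,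
      LinearMap.id_apply, sub_eq_zero] at ha hb ⊢
    calc S * (a * b * S) = S * (a * 1 * b * S) := by rw [mul_one]
      _ = (S * (a * S)) * (S * (b * S)) := by rw [← hSS]; noncomm_ring
      _ = _ := by rw [ha, hb, gsign_add, smul_mul_smul_comm]
  d := LinearMap.mulLeft k D -
    LinearMap.mulRight k D ∘ₗ LinearMap.mulLeft k S ∘ₗ LinearMap.mulRight k S
  d_mem i a ha := by
    simp only [LinearMap.mem_ker, LinearMap.sub_apply, LinearMap.comp_apply,
      LinearMap.mulLeft_apply, LinearMap.mulRight_apply, LinearMap.smul_apply,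
      LinearMap.id_apply, sub_eq_zero] at ha ⊢
    have h1 : S * ((D * a - S * (a * S) * D) * S)
        = (S * D) * (a * S) - (S * S) * a * ((S * D) * S) := by noncomm_ring
    have h2 : D * S * S = D := by rw [mul_assoc, hSS, mul_one]
    have h3 : D * S * (a * S) = D * (S * (a * S)) := by noncomm_ring
    rw [h1, hSS, hSD, neg_mul, neg_mul, h2, h3, ha, gsign_add, gsign_one, smul_mul_assoc,
      smul_sub, smul_smul, one_mul, mul_neg, mul_smul_comm, mul_assoc, mul_comm (-1) (gsign k i),
      ← mul_assoc, gsign_mul_self]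
    module
  leibniz i a b ha := by
    change _ = _ + gsign k i • _
    simp only [LinearMap.mem_ker, LinearMap.sub_apply, LinearMap.comp_apply,
      LinearMap.mulLeft_apply, LinearMap.mulRight_apply, LinearMap.smul_apply,
      LinearMap.id_apply, sub_eq_zero] at ha ⊢
    have h1 : S * (a * b * S) = (S * (a * S)) * (S * (b * S)) := by
      calc S * (a * b * S) = S * (a * 1 * b * S) := by rw [mul_one]
        _ = (S * (a * S)) * (S * (b * S)) := by rw [← hSS]; noncomm_ring
    rw [h1, ← smul_mul_assoc, ← ha]
    noncomm_ring
  d_sq a := by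
    simp only [LinearMap.sub_apply, LinearMap.comp_apply,
      LinearMap.mulLeft_apply, LinearMap.mulRight_apply]
    have h1 : D * (D * a - S * (a * S) * D) - S * ((D * a - S * (a * S) * D) * S) * D
        = (D * D) * a - D * S * a * S * D - (S * D) * a * S * D
          + (S * S) * a * S * D * (S * D) := by noncomm_ring
    have h2 : (S * S) * a * S * D * -(D * S) = -((S * S) * a * S * (D * D) * S) := by
      noncomm_ring
    rw [h1, hSD, h2, hDD]
    noncomm_ring

/-- The algebra map out of `k × k` sending `(1, 0)` to a given idempotent. -/
def prodLift {k : Type} [Field k] {B : Type} [Ring B] [Algebra k B] (E : B) (hE : E * E = E) :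
    (k × k) →ₐ[k] B :=
  AlgHom.ofLinearMap
    ((LinearMap.fst k k k).smulRight E + (LinearMap.snd k k k).smulRight (1 - E))
    (by simp)
    (fun x y => by
      simp only [LinearMap.add_apply, LinearMap.smulRight_apply, LinearMap.fst_apply,
        LinearMap.snd_apply, Prod.fst_mul, Prod.snd_mul, add_mul, mul_add, smul_mul_smul_comm,
        sub_mul, mul_sub, hE, mul_one, one_mul, sub_self, smul_zero, add_zero, zero_add, sub_zero])

theorem prodLift_apply {k : Type} [Field k] {B : Type} [Ring B] [Algebra k B] (E : B)
    (hE : E * E = E) : prodLift (k := k) E hE (1, 0) = E := by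
  change (1 : k) • E + (0 : k) • (1 - E) = E
  simp

/-- The ground field as a dg algebra with zero differential. -/
def groundDGAlg (k : Type) [Field k] : DGAlg k where
  carrier := k
  grading _ := ⊤
  one_mem := trivial
  mul_mem _ _ _ _ _ _ := trivial
  d := 0
  d_mem _ _ _ := trivial
  leibniz _ _ _ _ := by simp
  d_sq _ := rfl

namespace DGAlg

variable {k : Type} [Field k] (Ω : DGAlg k)

theorem leibniz_gsign {i : ℤ} {a : Ω.carrier} (b : Ω.carrier) (ha : a ∈ Ω.grading i) :
    Ω.d (a * b) = Ω.d a * b + gsign k i • (a * Ω.d b) :=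
  Ω.leibniz i a b ha

theorem leibniz_zero {a : Ω.carrier} (b : Ω.carrier) (ha : a ∈ Ω.grading 0) :
    Ω.d (a * b) = Ω.d a * b + a * Ω.d b := by
  rw [Ω.leibniz_gsign b ha, gsign_zero, one_smul]

theorem d_one : Ω.d 1 = 0 := by
  simpa using Ω.leibniz_zero 1 Ω.one_mem

/-- A subalgebra stable under the differential, as a dg algebra. -/
def sub (S : Subalgebra k Ω.carrier) (hS : ∀ x ∈ S, Ω.d x ∈ S) : DGAlg k where
  carrier := S
  grading i := (Ω.grading i).comap S.val.toLinearMap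
  one_mem := Ω.one_mem
  mul_mem i j a b := Ω.mul_mem i j a b
  d := Ω.d.restrict (p := Subalgebra.toSubmodule S) (q := Subalgebra.toSubmodule S) hS
  d_mem i a := Ω.d_mem i a
  leibniz i a b ha := Subtype.ext (Ω.leibniz i a b ha)
  d_sq a := Subtype.ext (Ω.d_sq a)

theorem d_mem_adjoin {e : Ω.carrier} (he : e ∈ Ω.grading 0) {x : Ω.carrier}
    (hx : x ∈ Algebra.adjoin k {e, Ω.d e}) : Ω.d x ∈ Algebra.adjoin k {e, Ω.d e} := by
  set S := Algebra.adjoin k {e, Ω.d e}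
  have he' : e ∈ S := Algebra.subset_adjoin (by simp)
  have hde' : Ω.d e ∈ S := Algebra.subset_adjoin (by simp)
  have key : ∀ w ∈ Submonoid.closure {e, Ω.d e},
      (∃ i, w ∈ Ω.grading i) ∧ w ∈ S ∧ Ω.d w ∈ S := by
    intro w hw
    induction hw using Submonoid.closure_induction with
    | mem x hx =>
      rcases hx with rfl | rfl
      · exact ⟨⟨0, he⟩, he', hde'⟩
      · exact ⟨⟨_, Ω.d_mem 0 e he⟩, hde', by rw [Ω.d_sq]; exact S.zero_mem⟩
    | one => exact ⟨⟨0, Ω.one_mem⟩, S.one_mem, by rw [Ω.d_one]; exact S.zero_mem⟩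
    | mul x y _ _ hx hy =>
      obtain ⟨⟨i, hi⟩, hxS, hdx⟩ := hx
      obtain ⟨⟨j, hj⟩, hyS, hdy⟩ := hy
      refine ⟨⟨_, Ω.mul_mem i j x y hi hj⟩, S.mul_mem hxS hyS, ?_⟩
      rw [Ω.leibniz_gsign y hi]
      exact S.add_mem (S.mul_mem hdx hyS) (S.smul_mem (S.mul_mem hxS hdy) _)
  have hx' : x ∈ Submodule.span k (Submonoid.closure {e, Ω.d e} : Set Ω.carrier) := by
    rw [← Algebra.adjoin_eq_span]; exact hx
  clear hx
  induction hx' using Submodule.span_induction with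
  | mem x h => exact (key x h).2.2
  | zero => rw [map_zero]; exact S.zero_mem
  | add x y _ _ ihx ihy => rw [map_add]; exact S.add_mem ihx ihy
  | smul c x _ ih => rw [map_smul]; exact S.smul_mem ih c

/-- The dg envelope of `k × k` is generated as an algebra by `e` and `de`. -/
theorem adjoin_eq_top (ι : (k × k) →ₐ[k] Ω.carrier) (hι0 : ι (1, 0) ∈ Ω.grading 0)
    (huniv : ∀ (B : DGAlg k) (f : (k × k) →ₐ[k] B.carrier), f (1, 0) ∈ B.grading 0 →
      ∃! F : Ω.carrier →ₐ[k] B.carrier,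
        (∀ a, F (Ω.d a) = B.d (F a)) ∧
        (∀ i x, x ∈ Ω.grading i → F x ∈ B.grading i) ∧
        F.comp ι = f) :
    Algebra.adjoin k {ι (1, 0), Ω.d (ι (1, 0))} = ⊤ := by
  set S := Algebra.adjoin k {ι (1, 0), Ω.d (ι (1, 0))}
  have hιS : ∀ x, ι x ∈ S := by
    rintro ⟨a, b⟩
    have h : ((a, b) : k × k) = a • (1, 0) + b • (1 - (1, 0)) := by ext <;> simp
    have he : ι (1, 0) ∈ S := Algebra.subset_adjoin (by simp)
    rw [h, map_add, map_smul, map_smul, map_sub, map_one]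
    exact S.add_mem (S.smul_mem he a) (S.smul_mem (S.sub_mem S.one_mem he) b)
  obtain ⟨F, ⟨hFd, hFg, hFι⟩, -⟩ :=
    huniv (Ω.sub S fun x hx => Ω.d_mem_adjoin hι0 hx) (ι.codRestrict S hιS) hι0
  have h := (huniv Ω ι hι0).unique
    (y₁ := S.val.comp F) (y₂ := AlgHom.id k Ω.carrier)
    ⟨fun a => congrArg Subtype.val (hFd a), fun i x hx => hFg i x hx, by
      ext1 x
      exact congrArg Subtype.val (DFunLike.congr_fun hFι x)⟩
    ⟨fun _ => rfl, fun _ _ hx => hx, rfl⟩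
  rw [eq_top_iff]
  intro x _
  have hx : S.val (F x) = x := DFunLike.congr_fun h x
  rw [← hx]
  exact (F x).2

end DGAlg

section Generation

variable {k A : Type} [Field k] [Ring A] [Algebra k A] {s : Set A}

theorem Submodule.mul_left_mem_of_adjoin_eq_top (hs : Algebra.adjoin k s = ⊤)
    (N : Submodule k A) (hN : ∀ g ∈ s, ∀ x ∈ N, g * x ∈ N) (a : A) : ∀ x ∈ N, a * x ∈ N := by
  have ha : a ∈ Algebra.adjoin k s := hs ▸ Algebra.mem_top
  induction ha using Algebra.adjoin_induction with
  | mem g hg => exact hN g hg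
  | algebraMap r =>
    intro x hx
    rw [← Algebra.smul_def]
    exact N.smul_mem r hx
  | add a b _ _ iha ihb =>
    intro x hx
    rw [add_mul]
    exact N.add_mem (iha x hx) (ihb x hx)
  | mul a b _ _ iha ihb =>
    intro x hx
    rw [mul_assoc]
    exact iha _ (ihb x hx)

theorem Submodule.mul_right_mem_of_adjoin_eq_top (hs : Algebra.adjoin k s = ⊤)
    (N : Submodule k A) (hN : ∀ g ∈ s, ∀ x ∈ N, x * g ∈ N) (a : A) : ∀ x ∈ N, x * a ∈ N := by
  have ha : a ∈ Algebra.adjoin k s := hs ▸ Algebra.mem_top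
  induction ha using Algebra.adjoin_induction with
  | mem g hg => exact hN g hg
  | algebraMap r =>
    intro x hx
    rw [← Algebra.commutes, ← Algebra.smul_def]
    exact N.smul_mem r hx
  | add a b _ _ iha ihb =>
    intro x hx
    rw [mul_add]
    exact N.add_mem (iha x hx) (ihb x hx)
  | mul a b _ _ iha ihb =>
    intro x hx
    rw [← mul_assoc]
    exact ihb _ (iha x hx)

theorem Submodule.eq_top_of_mul_left_mem (hs : Algebra.adjoin k s = ⊤) (N : Submodule k A)
    (h1 : 1 ∈ N) (hN : ∀ g ∈ s, ∀ x ∈ N, g * x ∈ N) : N = ⊤ := by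
  rw [eq_top_iff]
  intro a _
  simpa using N.mul_left_mem_of_adjoin_eq_top hs hN a 1 h1

theorem LinearMap.ext_of_mul_left {V : Type} [AddCommGroup V] [Module k V]
    (hs : Algebra.adjoin k s = ⊤) {Φ Ψ : A →ₗ[k] V} (h1 : Φ 1 = Ψ 1)
    (h : ∀ g ∈ s, ∀ x, Φ x = Ψ x → Φ (g * x) = Ψ (g * x)) : Φ = Ψ :=
  LinearMap.eqLocus_eq_top.mp (Submodule.eq_top_of_mul_left_mem hs (LinearMap.eqLocus Φ Ψ) h1 h)

end Generation

section SkewPrimitive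

variable {k A : Type} [Field k] [Ring A] [Algebra k A]

/-- Left multiplication by `e ⊗ e`. -/
def leftGrouplike (k : Type) {A : Type} [Field k] [Ring A] [Algebra k A] (e : A) :
    Module.End k (A ⊗[k] A) :=
  TensorProduct.map (LinearMap.mulLeft k e) (LinearMap.mulLeft k e)

/-- Koszul-signed left multiplication by `x ⊗ e + e ⊗ x`, for `e` even and `x` odd. -/
def leftPrimitive (σ : A →ₗ[k] A) (e x : A) : Module.End k (A ⊗[k] A) :=
  TensorProduct.map (LinearMap.mulLeft k x) (LinearMap.mulLeft k e) +
    TensorProduct.map (LinearMap.mulLeft k e ∘ₗ σ) (LinearMap.mulLeft k x)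

/-- Right multiplication by `e ⊗ e`. -/
def rightGrouplike (k : Type) {A : Type} [Field k] [Ring A] [Algebra k A] (e : A) :
    Module.End k (A ⊗[k] A) :=
  TensorProduct.map (LinearMap.mulRight k e) (LinearMap.mulRight k e)

/-- Koszul-signed right multiplication by `x ⊗ e + e ⊗ x`, for `e` even and `x` odd. -/
def rightPrimitive (σ : A →ₗ[k] A) (e x : A) : Module.End k (A ⊗[k] A) :=
  TensorProduct.map (LinearMap.mulRight k x) (LinearMap.mulRight k e ∘ₗ σ) +
    TensorProduct.map (LinearMap.mulRight k e) (LinearMap.mulRight k x)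

@[simp] theorem leftGrouplike_tmul (e a b : A) :
    leftGrouplike k e (a ⊗ₜ b) = (e * a) ⊗ₜ (e * b) := rfl

@[simp] theorem leftPrimitive_tmul (σ : A →ₗ[k] A) (e x a b : A) :
    leftPrimitive σ e x (a ⊗ₜ b) = (x * a) ⊗ₜ (e * b) + (e * σ a) ⊗ₜ (x * b) := rfl

@[simp] theorem rightGrouplike_tmul (e a b : A) :
    rightGrouplike k e (a ⊗ₜ b) = (a * e) ⊗ₜ (b * e) := rfl

@[simp] theorem rightPrimitive_tmul (σ : A →ₗ[k] A) (e x a b : A) :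
    rightPrimitive σ e x (a ⊗ₜ b) = (a * x) ⊗ₜ (σ b * e) + (a * e) ⊗ₜ (b * x) := rfl

variable {σ : A →ₗ[k] A} {e x : A} {Δ : A →ₗ[k] A ⊗[k] A}

theorem comul_parity (hgen : Algebra.adjoin k {e, x} = ⊤)
    (hσ1 : σ 1 = 1) (hσm : ∀ a b, σ (a * b) = σ a * σ b) (hσe : σ e = e) (hσx : σ x = -x)
    (hΔ1 : Δ 1 = 1 ⊗ₜ 1) (hΔe : ∀ y, Δ (e * y) = leftGrouplike k e (Δ y))
    (hΔx : ∀ y, Δ (x * y) = leftPrimitive σ e x (Δ y)) (y : A) :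
    Δ (σ y) = TensorProduct.map σ σ (Δ y) := by
  have he : ∀ z, TensorProduct.map σ σ (leftGrouplike k e z) =
      leftGrouplike k e (TensorProduct.map σ σ z) := fun z => by
    induction z with
    | zero => simp
    | add u v hu hv => simp only [map_add, hu, hv]
    | tmul a b => simp [hσm, hσe]
  have hx : ∀ z, TensorProduct.map σ σ (leftPrimitive σ e x z) =
      -leftPrimitive σ e x (TensorProduct.map σ σ z) := fun z => by
    induction z with
    | zero => simp
    | add u v hu hv => simp only [map_add, hu, hv, neg_add]
    | tmul a b =>
      simp [hσm, hσe, hσx, TensorProduct.neg_tmul, TensorProduct.tmul_neg, add_comm]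
  refine DFunLike.congr_fun (LinearMap.ext_of_mul_left (Φ := Δ ∘ₗ σ)
    (Ψ := TensorProduct.map σ σ ∘ₗ Δ) hgen (by simp [hσ1, hΔ1]) ?_) y
  rintro g (rfl | rfl) y ih <;> simp only [LinearMap.comp_apply] at ih ⊢
  · rw [hσm, hσe, hΔe, hΔe, he, ih]
  · rw [hσm, hσx, neg_mul, map_neg, hΔx, hΔx, hx, ih]

theorem comul_coassoc (hgen : Algebra.adjoin k {e, x} = ⊤)
    (hΔσ : ∀ y, Δ (σ y) = TensorProduct.map σ σ (Δ y))
    (hΔ1 : Δ 1 = 1 ⊗ₜ 1) (hΔe : ∀ y, Δ (e * y) = leftGrouplike k e (Δ y))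
    (hΔx : ∀ y, Δ (x * y) = leftPrimitive σ e x (Δ y)) :
    (TensorProduct.assoc k A A A).toLinearMap ∘ₗ TensorProduct.map Δ LinearMap.id ∘ₗ Δ
      = TensorProduct.map LinearMap.id Δ ∘ₗ Δ := by
  have he : (TensorProduct.assoc k A A A).toLinearMap ∘ₗ
        TensorProduct.map (leftGrouplike k e) (LinearMap.mulLeft k e) =
      TensorProduct.map (LinearMap.mulLeft k e) (leftGrouplike k e) ∘ₗ
        (TensorProduct.assoc k A A A).toLinearMap :=
    TensorProduct.ext_threefold fun a b c => by simp
  have hx : (TensorProduct.assoc k A A A).toLinearMap ∘ₗ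
        (TensorProduct.map (leftPrimitive σ e x) (LinearMap.mulLeft k e) +
          TensorProduct.map (leftGrouplike k e ∘ₗ TensorProduct.map σ σ)
            (LinearMap.mulLeft k x)) =
      (TensorProduct.map (LinearMap.mulLeft k x) (leftGrouplike k e) +
          TensorProduct.map (LinearMap.mulLeft k e ∘ₗ σ) (leftPrimitive σ e x)) ∘ₗ
        (TensorProduct.assoc k A A A).toLinearMap :=
    TensorProduct.ext_threefold fun a b c => by
      simp [TensorProduct.add_tmul, TensorProduct.tmul_add, add_assoc]
  have hle : TensorProduct.map Δ LinearMap.id ∘ₗ leftGrouplike k e =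
      TensorProduct.map (leftGrouplike k e) (LinearMap.mulLeft k e) ∘ₗ
        TensorProduct.map Δ LinearMap.id :=
    TensorProduct.ext' fun a b => by simp [hΔe]
  have hre : TensorProduct.map LinearMap.id Δ ∘ₗ leftGrouplike k e =
      TensorProduct.map (LinearMap.mulLeft k e) (leftGrouplike k e) ∘ₗ
        TensorProduct.map LinearMap.id Δ :=
    TensorProduct.ext' fun a b => by simp [hΔe]
  have hlx : TensorProduct.map Δ LinearMap.id ∘ₗ leftPrimitive σ e x =
      (TensorProduct.map (leftPrimitive σ e x) (LinearMap.mulLeft k e) +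
          TensorProduct.map (leftGrouplike k e ∘ₗ TensorProduct.map σ σ)
            (LinearMap.mulLeft k x)) ∘ₗ
        TensorProduct.map Δ LinearMap.id :=
    TensorProduct.ext' fun a b => by simp [hΔe, hΔx, hΔσ]
  have hrx : TensorProduct.map LinearMap.id Δ ∘ₗ leftPrimitive σ e x =
      (TensorProduct.map (LinearMap.mulLeft k x) (leftGrouplike k e) +
          TensorProduct.map (LinearMap.mulLeft k e ∘ₗ σ) (leftPrimitive σ e x)) ∘ₗ
        TensorProduct.map LinearMap.id Δ :=
    TensorProduct.ext' fun a b => by simp [hΔe, hΔx]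
  refine LinearMap.ext_of_mul_left hgen (by simp [hΔ1]) ?_
  rintro g (rfl | rfl) y ih <;> simp only [LinearMap.comp_apply] at ih ⊢
  · rw [hΔe]
    have h1 := DFunLike.congr_fun hle (Δ y)
    have h2 := DFunLike.congr_fun hre (Δ y)
    have h3 := DFunLike.congr_fun he (TensorProduct.map Δ LinearMap.id (Δ y))
    simp only [LinearMap.comp_apply] at h1 h2 h3
    rw [h1, h2, h3, ih]
  · rw [hΔx]
    have h1 := DFunLike.congr_fun hlx (Δ y)
    have h2 := DFunLike.congr_fun hrx (Δ y)
    have h3 := DFunLike.congr_fun hx (TensorProduct.map Δ LinearMap.id (Δ y))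
    rw [LinearMap.comp_apply, LinearMap.comp_apply] at h1 h2 h3
    rw [h1, h2, h3, ih]

theorem comul_counit (hgen : Algebra.adjoin k {e, x} = ⊤)
    (hσ1 : σ 1 = 1) (hσm : ∀ a b, σ (a * b) = σ a * σ b) (hσe : σ e = e) (hσx : σ x = -x)
    (hΔ1 : Δ 1 = 1 ⊗ₜ 1) (hΔe : ∀ y, Δ (e * y) = leftGrouplike k e (Δ y))
    (hΔx : ∀ y, Δ (x * y) = leftPrimitive σ e x (Δ y))
    (ε : A →ₐ[k] k) (hεe : ε e = 1) (hεx : ε x = 0) :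
    (TensorProduct.lid k A).toLinearMap ∘ₗ
        TensorProduct.map ε.toLinearMap LinearMap.id ∘ₗ Δ = LinearMap.id ∧
      (TensorProduct.rid k A).toLinearMap ∘ₗ
        TensorProduct.map LinearMap.id ε.toLinearMap ∘ₗ Δ = LinearMap.id := by
  have hεσ : ∀ y, ε (σ y) = ε y := by
    refine DFunLike.congr_fun (LinearMap.ext_of_mul_left (Φ := ε.toLinearMap ∘ₗ σ)
      (Ψ := ε.toLinearMap) hgen (by simp [hσ1]) ?_)
    rintro g (rfl | rfl) y ih <;> simp only [LinearMap.comp_apply, AlgHom.toLinearMap_apply] at ih ⊢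
    · rw [hσm, hσe, map_mul, map_mul, ih]
    · rw [hσm, hσx, map_mul, map_mul, map_neg, hεx]; simp
  have hle : ∀ z, TensorProduct.lid k A (TensorProduct.map ε.toLinearMap LinearMap.id
        (leftGrouplike k e z)) =
      e * TensorProduct.lid k A (TensorProduct.map ε.toLinearMap LinearMap.id z) := fun z => by
    induction z with
    | zero => simp
    | add u v hu hv => simp only [map_add, hu, hv, mul_add]
    | tmul a b => simp [hεe]
  have hlx : ∀ z, TensorProduct.lid k A (TensorProduct.map ε.toLinearMap LinearMap.id
        (leftPrimitive σ e x z)) =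
      x * TensorProduct.lid k A (TensorProduct.map ε.toLinearMap LinearMap.id z) := fun z => by
    induction z with
    | zero => simp
    | add u v hu hv => simp only [map_add, hu, hv, mul_add]
    | tmul a b => simp [hεe, hεx, hεσ]
  have hre : ∀ z, TensorProduct.rid k A (TensorProduct.map LinearMap.id ε.toLinearMap
        (leftGrouplike k e z)) =
      e * TensorProduct.rid k A (TensorProduct.map LinearMap.id ε.toLinearMap z) := fun z => by
    induction z with
    | zero => simp
    | add u v hu hv => simp only [map_add, hu, hv, mul_add]
    | tmul a b => simp [hεe]
  have hrx : ∀ z, TensorProduct.rid k A (TensorProduct.map LinearMap.id ε.toLinearMap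
        (leftPrimitive σ e x z)) =
      x * TensorProduct.rid k A (TensorProduct.map LinearMap.id ε.toLinearMap z) := fun z => by
    induction z with
    | zero => simp
    | add u v hu hv => simp only [map_add, hu, hv, mul_add]
    | tmul a b => simp [hεe, hεx]
  constructor <;> refine LinearMap.ext_of_mul_left hgen (by simp [hΔ1]) ?_ <;>
    rintro g (rfl | rfl) y ih <;>
    simp only [LinearMap.comp_apply, LinearEquiv.coe_coe, LinearMap.id_apply] at ih ⊢
  · rw [hΔe, hle, ih]
  · rw [hΔx, hlx, ih]
  · rw [hΔe, hre, ih]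
  · rw [hΔx, hrx, ih]

/-- The submodule `I ⊗ A + A ⊗ I` of `A ⊗ A`. -/
def coidealSpan (I : Submodule k A) : Submodule k (A ⊗[k] A) :=
  LinearMap.range (TensorProduct.map I.subtype (LinearMap.id (M := A))) ⊔
    LinearMap.range (TensorProduct.map (LinearMap.id (M := A)) I.subtype)

theorem tmul_mem_coidealSpan_left {I : Submodule k A} {a : A} (ha : a ∈ I) (b : A) :
    a ⊗ₜ b ∈ coidealSpan I :=
  Submodule.mem_sup_left ⟨(⟨a, ha⟩ : I) ⊗ₜ b, rfl⟩

theorem tmul_mem_coidealSpan_right {I : Submodule k A} (a : A) {b : A} (hb : b ∈ I) :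
    a ⊗ₜ b ∈ coidealSpan I :=
  Submodule.mem_sup_right ⟨a ⊗ₜ (⟨b, hb⟩ : I), rfl⟩

theorem map_mem_coidealSpan {I : Submodule k A} {p q : A →ₗ[k] A}
    (hp : ∀ y ∈ I, p y ∈ I) (hq : ∀ y ∈ I, q y ∈ I) :
    ∀ z ∈ coidealSpan I, TensorProduct.map p q z ∈ coidealSpan I := by
  change coidealSpan I ≤ (coidealSpan I).comap (TensorProduct.map p q)
  refine sup_le ?_ ?_
  · rintro _ ⟨t, rfl⟩
    induction t with
    | zero => simp
    | add u v hu hv => rw [map_add]; exact Submodule.add_mem _ hu hv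
    | tmul a b => exact tmul_mem_coidealSpan_left (hp a a.2) _
  · rintro _ ⟨t, rfl⟩
    induction t with
    | zero => simp
    | add u v hu hv => rw [map_add]; exact Submodule.add_mem _ hu hv
    | tmul a b => exact tmul_mem_coidealSpan_right _ (hq b b.2)

theorem comul_mem_coidealSpan (hgen : Algebra.adjoin k {e, x} = ⊤)
    (hσm : ∀ a b, σ (a * b) = σ a * σ b) (hσe : σ e = e) (hσx : σ x = -x)
    (hΔ1 : Δ 1 = 1 ⊗ₜ 1) (hΔe : ∀ y, Δ (e * y) = leftGrouplike k e (Δ y))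
    (hΔx : ∀ y, Δ (x * y) = leftPrimitive σ e x (Δ y))
    (hΔe' : ∀ y, Δ (y * e) = rightGrouplike k e (Δ y))
    (hΔx' : ∀ y, Δ (y * x) = rightPrimitive σ e x (Δ y)) {I : Submodule k A}
    (hI : I = Submodule.span k {w : A | ∃ a b : A, w = a * (e * x) * b}) :
    ∀ z ∈ I, Δ z ∈ coidealSpan I := by
  have hl : ∀ c, ∀ y ∈ I, LinearMap.mulLeft k c y ∈ I := fun c => by
    change I ≤ I.comap _
    conv_lhs => rw [hI]
    rw [Submodule.span_le]
    rintro _ ⟨a, b, rfl⟩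
    rw [hI]
    exact Submodule.subset_span ⟨c * a, b, by simp [mul_assoc]⟩
  have hr : ∀ c, ∀ y ∈ I, LinearMap.mulRight k c y ∈ I := fun c => by
    change I ≤ I.comap _
    conv_lhs => rw [hI]
    rw [Submodule.span_le]
    rintro _ ⟨a, b, rfl⟩
    rw [hI]
    exact Submodule.subset_span ⟨a, b * c, by simp [mul_assoc]⟩
  have hσI : ∀ y ∈ I, σ y ∈ I := by
    change I ≤ I.comap _
    conv_lhs => rw [hI]
    rw [Submodule.span_le]
    rintro _ ⟨a, b, rfl⟩
    rw [hI]
    exact Submodule.subset_span ⟨-σ a, σ b, by simp [hσm, hσe, hσx]⟩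
  have hlσ : ∀ y ∈ I, (LinearMap.mulLeft k e ∘ₗ σ) y ∈ I := fun y hy => hl e (σ y) (hσI y hy)
  have hrσ : ∀ y ∈ I, (LinearMap.mulRight k e ∘ₗ σ) y ∈ I := fun y hy => hr e (σ y) (hσI y hy)
  have hω : e * x ∈ I := hI ▸ Submodule.subset_span ⟨1, 1, by simp⟩
  have hleft := Submodule.mul_left_mem_of_adjoin_eq_top hgen ((coidealSpan I).comap Δ) (by
    rintro g (rfl | rfl) y hy <;> rw [Submodule.mem_comap] at hy ⊢
    · rw [hΔe]
      exact map_mem_coidealSpan (hl _) (hl _) _ hy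
    · rw [hΔx]
      exact Submodule.add_mem _ (map_mem_coidealSpan (hl _) (hl _) _ hy)
        (map_mem_coidealSpan hlσ (hl _) _ hy))
  have hright := Submodule.mul_right_mem_of_adjoin_eq_top hgen ((coidealSpan I).comap Δ) (by
    rintro g (rfl | rfl) y hy <;> rw [Submodule.mem_comap] at hy ⊢
    · rw [hΔe']
      exact map_mem_coidealSpan (hr _) (hr _) _ hy
    · rw [hΔx']
      exact Submodule.add_mem _
        (map_mem_coidealSpan (hr _) hrσ _ hy)
        (map_mem_coidealSpan (hr _) (hr _) _ hy))
  have hΔω : Δ (e * x) ∈ coidealSpan I := by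
    rw [← mul_one x, hΔe, hΔx, hΔ1, leftPrimitive_tmul, map_add, leftGrouplike_tmul,
      leftGrouplike_tmul, mul_one x]
    exact Submodule.add_mem _ (tmul_mem_coidealSpan_left hω _) (tmul_mem_coidealSpan_right _ hω)
  change I ≤ (coidealSpan I).comap Δ
  conv_lhs => rw [hI]
  rw [Submodule.span_le]
  rintro _ ⟨a, b, rfl⟩
  exact hright b _ (hleft a _ hΔω)

end SkewPrimitive

namespace DGAlg

variable {k : Type} [Field k] (Ω : DGAlg k)

theorem span_homogeneous_eq_top {e : Ω.carrier} (he : e ∈ Ω.grading 0)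
    (hgen : Algebra.adjoin k {e, Ω.d e} = ⊤) :
    Submodule.span k {a : Ω.carrier | ∃ i, a ∈ Ω.grading i} = ⊤ := by
  refine Submodule.eq_top_of_mul_left_mem hgen _ (Submodule.subset_span ⟨0, Ω.one_mem⟩) ?_
  intro g hg
  obtain ⟨j, hj⟩ : ∃ j, g ∈ Ω.grading j := by
    rcases hg with rfl | rfl
    exacts [⟨0, he⟩, ⟨_, Ω.d_mem 0 e he⟩]
  change _ ≤ (Submodule.span k _).comap (LinearMap.mulLeft k g)
  rw [Submodule.span_le]
  rintro a ⟨i, hi⟩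
  exact Submodule.subset_span ⟨_, Ω.mul_mem j i g a hj hi⟩

variable {Ω}

theorem ext_homogeneous (hspan : Submodule.span k {a : Ω.carrier | ∃ i, a ∈ Ω.grading i} = ⊤)
    {V : Type} [AddCommGroup V] [Module k V] {Φ Ψ : Ω.carrier →ₗ[k] V}
    (h : ∀ i, ∀ a ∈ Ω.grading i, Φ a = Ψ a) : Φ = Ψ :=
  LinearMap.ext_on hspan fun a ⟨i, hi⟩ => h i a hi

theorem ext_homogeneous_tmul
    (hspan : Submodule.span k {a : Ω.carrier | ∃ i, a ∈ Ω.grading i} = ⊤)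
    {V : Type} [AddCommGroup V] [Module k V] {Φ Ψ : Ω.carrier ⊗[k] Ω.carrier →ₗ[k] V}
    (h : ∀ i j, ∀ a ∈ Ω.grading i, ∀ b ∈ Ω.grading j, Φ (a ⊗ₜ b) = Ψ (a ⊗ₜ b)) : Φ = Ψ :=
  TensorProduct.ext <| ext_homogeneous hspan fun i a ha =>
    ext_homogeneous hspan fun j b hb => h i j a ha b hb

variable {σ : Ω.carrier →ₗ[k] Ω.carrier}

theorem parity_parity
    (hspan : Submodule.span k {a : Ω.carrier | ∃ i, a ∈ Ω.grading i} = ⊤)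
    (hσ : ∀ i (x : Ω.carrier), x ∈ Ω.grading i → σ x = gsign k i • x)
    (x : Ω.carrier) : σ (σ x) = x := by
  refine DFunLike.congr_fun (ext_homogeneous (Φ := σ ∘ₗ σ) (Ψ := LinearMap.id) hspan ?_) x
  intro i a ha
  simp [hσ i a ha, smul_smul, gsign_mul_self]

theorem parity_d
    (hspan : Submodule.span k {a : Ω.carrier | ∃ i, a ∈ Ω.grading i} = ⊤)
    (hσ : ∀ i (x : Ω.carrier), x ∈ Ω.grading i → σ x = gsign k i • x)
    (x : Ω.carrier) : σ (Ω.d x) = -Ω.d (σ x) := by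
  refine DFunLike.congr_fun (ext_homogeneous (Φ := σ ∘ₗ Ω.d) (Ψ := -(Ω.d ∘ₗ σ)) hspan ?_) x
  intro i a ha
  simp [hσ i a ha, hσ _ _ (Ω.d_mem i a ha), gsign_add, gsign_one]

theorem parity_mul
    (hspan : Submodule.span k {a : Ω.carrier | ∃ i, a ∈ Ω.grading i} = ⊤)
    (hσ : ∀ i (x : Ω.carrier), x ∈ Ω.grading i → σ x = gsign k i • x)
    (x y : Ω.carrier) : σ (x * y) = σ x * σ y := by
  refine DFunLike.congr_fun (DFunLike.congr_fun (ext_homogeneous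
    (Φ := (LinearMap.mul k Ω.carrier).compr₂ σ)
    (Ψ := (LinearMap.mul k Ω.carrier).compl₁₂ σ σ) hspan ?_) x) y
  intro i a ha
  refine ext_homogeneous hspan fun j b hb => ?_
  simp [hσ i a ha, hσ j b hb, hσ _ _ (Ω.mul_mem i j a b ha hb), gsign_add, smul_smul, mul_comm]

theorem d_apply_mul {e : Ω.carrier} (he : e ∈ Ω.grading 0) (y : Ω.carrier) :
    Ω.d e * y = Ω.d (e * y) - e * Ω.d y := by
  rw [Ω.leibniz_zero y he, add_sub_cancel_right]

/-- The dg envelope acts on the complex `Ω ⊗ Ω`, with `e` acting by `e ⊗ e` and the differential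
acting by the graded commutator. -/
theorem exists_action
    (hspan : Submodule.span k {a : Ω.carrier | ∃ i, a ∈ Ω.grading i} = ⊤)
    (hσ : ∀ i (x : Ω.carrier), x ∈ Ω.grading i → σ x = gsign k i • x)
    (ι : (k × k) →ₐ[k] Ω.carrier) (hι0 : ι (1, 0) ∈ Ω.grading 0)
    (huniv : ∀ (B : DGAlg k) (f : (k × k) →ₐ[k] B.carrier), f (1, 0) ∈ B.grading 0 →
      ∃! F : Ω.carrier →ₐ[k] B.carrier,
        (∀ a, F (Ω.d a) = B.d (F a)) ∧
        (∀ i x, x ∈ Ω.grading i → F x ∈ B.grading i) ∧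
        F.comp ι = f) :
    ∃ F : Ω.carrier →ₐ[k] Module.End k (Ω.carrier ⊗[k] Ω.carrier),
      F (ι (1, 0)) = leftGrouplike k (ι (1, 0)) ∧
      F (Ω.d (ι (1, 0))) = leftPrimitive σ (ι (1, 0)) (Ω.d (ι (1, 0))) ∧
      ∀ a, F (Ω.d a) (1 ⊗ₜ 1) =
        (TensorProduct.map Ω.d LinearMap.id + TensorProduct.map σ Ω.d :
          Module.End k (Ω.carrier ⊗[k] Ω.carrier)) (F a (1 ⊗ₜ 1)) := by
  set e := ι (1, 0) with he
  have hee : e * e = e := by rw [he, ← map_mul]; simp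
  have hσσ := parity_parity hspan hσ
  have hσd := parity_d hspan hσ
  have hσm := parity_mul hspan hσ
  have hσe : σ e = e := by rw [hσ 0 e hι0, gsign_zero, one_smul]
  set D : Module.End k (Ω.carrier ⊗[k] Ω.carrier) :=
    TensorProduct.map Ω.d LinearMap.id + TensorProduct.map σ Ω.d with hD
  set S : Module.End k (Ω.carrier ⊗[k] Ω.carrier) := TensorProduct.map σ σ with hS
  have hSS : S * S = 1 := TensorProduct.ext' fun a b => by simp [hS, hσσ]
  have hSD : S * D = -(D * S) := TensorProduct.ext' fun a b => by
    simp [hS, hD, hσσ, hσd, TensorProduct.neg_tmul, TensorProduct.tmul_neg, add_comm]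
  have hDD : D * D = 0 := TensorProduct.ext' fun a b => by
    simp [hD, hσσ, hσd, Ω.d_sq, TensorProduct.neg_tmul]
  have hE : leftGrouplike k e * leftGrouplike k e = leftGrouplike k e :=
    TensorProduct.ext' fun a b => by simp [← mul_assoc, hee]
  have hSE : S * (leftGrouplike k e * S) = leftGrouplike k e :=
    TensorProduct.ext' fun a b => by simp [hS, hσm, hσe, hσσ]
  have hDE : D * leftGrouplike k e - leftGrouplike k e * D = leftPrimitive σ e (Ω.d e) :=
    TensorProduct.ext' fun a b => by
      simp only [hD, LinearMap.sub_apply, Module.End.mul_apply, LinearMap.add_apply,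
        TensorProduct.map_tmul, leftGrouplike_tmul, map_add, LinearMap.id_apply, hσm, hσe,
        leftPrimitive_tmul, d_apply_mul hι0, TensorProduct.sub_tmul, TensorProduct.tmul_sub]
      abel
  obtain ⟨F, ⟨hFd, -, hFι⟩, -⟩ : ∃! F : Ω.carrier →ₐ[k] Module.End k (Ω.carrier ⊗[k] Ω.carrier),
      (∀ a, F (Ω.d a) = D * F a - S * (F a * S) * D) ∧
      (∀ i x, x ∈ Ω.grading i → F x ∈ (endDGAlg D S hSS hSD hDD).grading i) ∧
      F.comp ι = prodLift (leftGrouplike k e) hE := by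
    refine huniv (endDGAlg D S hSS hSD hDD) (prodLift (leftGrouplike k e) hE) ?_
    have h : S * (prodLift (k := k) (leftGrouplike k e) hE (1, 0) * S) -
        gsign k 0 • prodLift (k := k) (leftGrouplike k e) hE (1, 0) = 0 := by
      rw [prodLift_apply, hSE, gsign_zero, one_smul, sub_self]
    exact h
  have hFe : F e = leftGrouplike k e :=
    (DFunLike.congr_fun hFι (1, 0)).trans (prodLift_apply _ hE)
  refine ⟨F, hFe, by rw [hFd, hFe, hSE, hDE], fun a => ?_⟩
  rw [hFd]
  simp [hD, Ω.d_one]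

variable {μ : Ω.carrier ⊗[k] Ω.carrier →ₗ[k] Ω.carrier ⊗[k] Ω.carrier →ₗ[k]
    Ω.carrier ⊗[k] Ω.carrier}
  {e : Ω.carrier}

theorem koszul_leftGrouplike
    (hspan : Submodule.span k {a : Ω.carrier | ∃ i, a ∈ Ω.grading i} = ⊤)
    (hμ : ∀ i j i' j' (a b a' b' : Ω.carrier),
      a ∈ Ω.grading i → b ∈ Ω.grading j → a' ∈ Ω.grading i' → b' ∈ Ω.grading j' →
      μ (a ⊗ₜ b) (a' ⊗ₜ b') = gsign k (j * i') • ((a * a') ⊗ₜ[k] (b * b')))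
    (he : e ∈ Ω.grading 0) (z : Ω.carrier ⊗[k] Ω.carrier) :
    μ (e ⊗ₜ e) z = leftGrouplike k e z := by
  refine DFunLike.congr_fun (ext_homogeneous_tmul hspan fun i j a ha b hb => ?_) z
  rw [hμ 0 0 i j _ _ _ _ he he ha hb]
  simp [gsign_zero]

theorem koszul_leftPrimitive
    (hspan : Submodule.span k {a : Ω.carrier | ∃ i, a ∈ Ω.grading i} = ⊤)
    (hσ : ∀ i (x : Ω.carrier), x ∈ Ω.grading i → σ x = gsign k i • x)
    (hμ : ∀ i j i' j' (a b a' b' : Ω.carrier),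
      a ∈ Ω.grading i → b ∈ Ω.grading j → a' ∈ Ω.grading i' → b' ∈ Ω.grading j' →
      μ (a ⊗ₜ b) (a' ⊗ₜ b') = gsign k (j * i') • ((a * a') ⊗ₜ[k] (b * b')))
    (he : e ∈ Ω.grading 0) (z : Ω.carrier ⊗[k] Ω.carrier) :
    μ (Ω.d e ⊗ₜ e + e ⊗ₜ Ω.d e) z = leftPrimitive σ e (Ω.d e) z := by
  refine DFunLike.congr_fun (ext_homogeneous_tmul hspan fun i j a ha b hb => ?_) z
  have hde := Ω.d_mem 0 e he
  rw [map_add, LinearMap.add_apply, hμ _ 0 i j _ _ _ _ hde he ha hb,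
    hμ 0 _ i j _ _ _ _ he hde ha hb]
  simp [gsign_zero, hσ i a ha, TensorProduct.smul_tmul']

theorem koszul_rightGrouplike
    (hspan : Submodule.span k {a : Ω.carrier | ∃ i, a ∈ Ω.grading i} = ⊤)
    (hμ : ∀ i j i' j' (a b a' b' : Ω.carrier),
      a ∈ Ω.grading i → b ∈ Ω.grading j → a' ∈ Ω.grading i' → b' ∈ Ω.grading j' →
      μ (a ⊗ₜ b) (a' ⊗ₜ b') = gsign k (j * i') • ((a * a') ⊗ₜ[k] (b * b')))
    (he : e ∈ Ω.grading 0) (z : Ω.carrier ⊗[k] Ω.carrier) :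
    μ z (e ⊗ₜ e) = rightGrouplike k e z := by
  refine DFunLike.congr_fun (ext_homogeneous_tmul (Φ := μ.flip (e ⊗ₜ e)) hspan
    fun i j a ha b hb => ?_) z
  rw [LinearMap.flip_apply, hμ i j 0 0 _ _ _ _ ha hb he he]
  simp [gsign_zero]

theorem koszul_rightPrimitive
    (hspan : Submodule.span k {a : Ω.carrier | ∃ i, a ∈ Ω.grading i} = ⊤)
    (hσ : ∀ i (x : Ω.carrier), x ∈ Ω.grading i → σ x = gsign k i • x)
    (hμ : ∀ i j i' j' (a b a' b' : Ω.carrier),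
      a ∈ Ω.grading i → b ∈ Ω.grading j → a' ∈ Ω.grading i' → b' ∈ Ω.grading j' →
      μ (a ⊗ₜ b) (a' ⊗ₜ b') = gsign k (j * i') • ((a * a') ⊗ₜ[k] (b * b')))
    (he : e ∈ Ω.grading 0) (z : Ω.carrier ⊗[k] Ω.carrier) :
    μ z (Ω.d e ⊗ₜ e + e ⊗ₜ Ω.d e) = rightPrimitive σ e (Ω.d e) z := by
  refine DFunLike.congr_fun (ext_homogeneous_tmul
    (Φ := μ.flip (Ω.d e ⊗ₜ e + e ⊗ₜ Ω.d e)) hspan fun i j a ha b hb => ?_) z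
  have hde := Ω.d_mem 0 e he
  rw [map_add, LinearMap.add_apply, LinearMap.flip_apply, LinearMap.flip_apply,
    hμ i j _ 0 _ _ _ _ ha hb hde he, hμ i j 0 _ _ _ _ _ ha hb he hde]
  simp [gsign_zero, hσ j b hb]

theorem koszul_leftGrouplike_assoc
    (hspan : Submodule.span k {a : Ω.carrier | ∃ i, a ∈ Ω.grading i} = ⊤)
    (hμ : ∀ i j i' j' (a b a' b' : Ω.carrier),
      a ∈ Ω.grading i → b ∈ Ω.grading j → a' ∈ Ω.grading i' → b' ∈ Ω.grading j' →
      μ (a ⊗ₜ b) (a' ⊗ₜ b') = gsign k (j * i') • ((a * a') ⊗ₜ[k] (b * b')))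
    (he : e ∈ Ω.grading 0) (u z : Ω.carrier ⊗[k] Ω.carrier) :
    μ (leftGrouplike k e u) z = leftGrouplike k e (μ u z) := by
  refine DFunLike.congr_fun (DFunLike.congr_fun (ext_homogeneous_tmul
    (Φ := μ ∘ₗ leftGrouplike k e) (Ψ := μ.compr₂ (leftGrouplike k e)) hspan
    fun i j a ha b hb => ?_) u) z
  refine ext_homogeneous_tmul hspan fun i' j' a' ha' b' hb' => ?_
  have h := Ω.mul_mem
  simp only [LinearMap.comp_apply, LinearMap.compr₂_apply, leftGrouplike_tmul]
  rw [hμ _ _ _ _ _ _ _ _ (h _ _ _ _ he ha) (h _ _ _ _ he hb) ha' hb',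
    hμ _ _ _ _ _ _ _ _ ha hb ha' hb']
  simp [mul_assoc]

theorem koszul_leftPrimitive_assoc
    (hspan : Submodule.span k {a : Ω.carrier | ∃ i, a ∈ Ω.grading i} = ⊤)
    (hσ : ∀ i (x : Ω.carrier), x ∈ Ω.grading i → σ x = gsign k i • x)
    (hμ : ∀ i j i' j' (a b a' b' : Ω.carrier),
      a ∈ Ω.grading i → b ∈ Ω.grading j → a' ∈ Ω.grading i' → b' ∈ Ω.grading j' →
      μ (a ⊗ₜ b) (a' ⊗ₜ b') = gsign k (j * i') • ((a * a') ⊗ₜ[k] (b * b')))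
    (he : e ∈ Ω.grading 0) (u z : Ω.carrier ⊗[k] Ω.carrier) :
    μ (leftPrimitive σ e (Ω.d e) u) z = leftPrimitive σ e (Ω.d e) (μ u z) := by
  refine DFunLike.congr_fun (DFunLike.congr_fun (ext_homogeneous_tmul
    (Φ := μ ∘ₗ leftPrimitive σ e (Ω.d e)) (Ψ := μ.compr₂ (leftPrimitive σ e (Ω.d e))) hspan
    fun i j a ha b hb => ?_) u) z
  refine ext_homogeneous_tmul hspan fun i' j' a' ha' b' hb' => ?_
  have h := Ω.mul_mem
  have hde := Ω.d_mem 0 e he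
  simp only [LinearMap.comp_apply, LinearMap.compr₂_apply, leftPrimitive_tmul, hσ i a ha,
    map_add, LinearMap.add_apply, mul_smul_comm, ← TensorProduct.smul_tmul', map_smul,
    LinearMap.smul_apply]
  rw [hμ _ _ _ _ _ _ _ _ (h _ _ _ _ hde ha) (h _ _ _ _ he hb) ha' hb',
    hμ _ _ _ _ _ _ _ _ (h _ _ _ _ he ha) (h _ _ _ _ hde hb) ha' hb',
    hμ _ _ _ _ _ _ _ _ ha hb ha' hb', map_smul, leftPrimitive_tmul,
    hσ _ _ (h _ _ _ _ ha ha')]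
  simp only [mul_assoc, zero_add, add_mul, one_mul, gsign_add, mul_smul_comm, smul_add,
    ← TensorProduct.smul_tmul', smul_smul]
  congr 2
  ring

end DGAlg

/-- Let `Ω = Ω(k × k)` be the dg algebra of noncommutative differential
forms on `A = k × k` (its dg envelope), with `e = ι(1,0)`.  There is a unique dg bialgebra
structure on `Ω` with `Δ(e) = e ⊗ e`: a unique multiplicative comultiplication
`Δ : Ω → Ω ⊗ Ω` (multiplicative for the Koszul-signed product `μT` on `Ω ⊗ Ω`) commuting
with the differentials and with `Δ(e) = e ⊗ e`; moreover any such `Δ` is coassociative,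
admits a counit, and the two-sided ideal generated by `e·de` is a coideal, so the quotient
`Ω/(e·de)` inherits a dg bialgebra structure. -/
theorem ncForms_dg_bialgebra
    {k : Type} [Field k]
    -- `Ω = Ω(k × k)`, the dg envelope of `k × k`
    (Ω : DGAlg k) (ι : (k × k) →ₐ[k] Ω.carrier)
    (hι0 : ι (1, 0) ∈ Ω.grading 0)
    (huniv : ∀ (B : DGAlg k) (f : (k × k) →ₐ[k] B.carrier), f (1, 0) ∈ B.grading 0 →
      ∃! F : Ω.carrier →ₐ[k] B.carrier,
        (∀ a, F (Ω.d a) = B.d (F a)) ∧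
        (∀ i x, x ∈ Ω.grading i → F x ∈ B.grading i) ∧
        F.comp ι = f)
    -- the parity operator on `Ω`
    (σ : Ω.carrier →ₗ[k] Ω.carrier)
    (hσ : ∀ i (x : Ω.carrier), x ∈ Ω.grading i → σ x = gsign k i • x)
    -- the Koszul-signed multiplication on `Ω ⊗ Ω`
    (μT : (Ω.carrier ⊗[k] Ω.carrier) → (Ω.carrier ⊗[k] Ω.carrier) →
      (Ω.carrier ⊗[k] Ω.carrier))
    (hμadd₁ : ∀ u v w, μT (u + v) w = μT u w + μT v w)
    (hμadd₂ : ∀ u v w, μT u (v + w) = μT u v + μT u w)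
    (hμsmul₁ : ∀ (c : k) u w, μT (c • u) w = c • μT u w)
    (hμsmul₂ : ∀ (c : k) u w, μT u (c • w) = c • μT u w)
    (hμT : ∀ i j i' j' (a b a' b' : Ω.carrier),
      a ∈ Ω.grading i → b ∈ Ω.grading j → a' ∈ Ω.grading i' → b' ∈ Ω.grading j' →
      μT (a ⊗ₜ b) (a' ⊗ₜ b') = gsign k (j * i') • ((a * a') ⊗ₜ[k] (b * b'))) :
    -- the differential on `Ω ⊗ Ω`
    let dT : Ω.carrier ⊗[k] Ω.carrier →ₗ[k] Ω.carrier ⊗[k] Ω.carrier :=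
      TensorProduct.map Ω.d LinearMap.id + TensorProduct.map σ Ω.d
    -- the two-sided ideal generated by `e·de`
    let I : Submodule k Ω.carrier := Submodule.span k
      {w : Ω.carrier | ∃ a b : Ω.carrier, w = a * (ι (1, 0) * Ω.d (ι (1, 0))) * b}
    -- uniqueness and existence of the comultiplication `Δ` with `Δ(e) = e ⊗ e`
    (∃! Δ : Ω.carrier →ₗ[k] Ω.carrier ⊗[k] Ω.carrier,
        Δ 1 = 1 ⊗ₜ 1 ∧
        (∀ a b : Ω.carrier, Δ (a * b) = μT (Δ a) (Δ b)) ∧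
        Δ (ι (1, 0)) = ι (1, 0) ⊗ₜ ι (1, 0) ∧
        (∀ a : Ω.carrier, Δ (Ω.d a) = dT (Δ a)))
    -- any such `Δ` makes `Ω` a dg bialgebra and `(e·de)` a coideal
    ∧ (∀ Δ : Ω.carrier →ₗ[k] Ω.carrier ⊗[k] Ω.carrier,
        Δ 1 = 1 ⊗ₜ 1 →
        (∀ a b : Ω.carrier, Δ (a * b) = μT (Δ a) (Δ b)) →
        Δ (ι (1, 0)) = ι (1, 0) ⊗ₜ ι (1, 0) →
        (∀ a : Ω.carrier, Δ (Ω.d a) = dT (Δ a)) →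
        -- coassociativity
        ((TensorProduct.assoc k Ω.carrier Ω.carrier Ω.carrier).toLinearMap
            ∘ₗ TensorProduct.map Δ LinearMap.id ∘ₗ Δ
          = TensorProduct.map LinearMap.id Δ ∘ₗ Δ)
        -- existence of a counit
        ∧ (∃ ε : Ω.carrier →ₗ[k] k, ε 1 = 1 ∧ (∀ a b, ε (a * b) = ε a * ε b) ∧
            (TensorProduct.lid k Ω.carrier).toLinearMap
                ∘ₗ TensorProduct.map ε LinearMap.id ∘ₗ Δ = LinearMap.id ∧
            (TensorProduct.rid k Ω.carrier).toLinearMap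
                ∘ₗ TensorProduct.map LinearMap.id ε ∘ₗ Δ = LinearMap.id)
        -- the ideal `(e·de)` is a coideal: `Δ(I) ⊆ I ⊗ Ω + Ω ⊗ I`
        ∧ (∀ z ∈ I, Δ z ∈
            LinearMap.range (TensorProduct.map I.subtype (LinearMap.id (M := Ω.carrier)))
              ⊔ LinearMap.range (TensorProduct.map (LinearMap.id (M := Ω.carrier))
                  I.subtype))) := by
  set e := ι (1, 0) with he
  intro dT I
  have hgen : Algebra.adjoin k {e, Ω.d e} = ⊤ := Ω.adjoin_eq_top ι hι0 huniv
  have hspan := Ω.span_homogeneous_eq_top hι0 hgen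
  obtain ⟨μ, hμ⟩ : ∃ μ : Ω.carrier ⊗[k] Ω.carrier →ₗ[k] Ω.carrier ⊗[k] Ω.carrier →ₗ[k]
      Ω.carrier ⊗[k] Ω.carrier, ∀ u v, μT u v = μ u v :=
    ⟨LinearMap.mk₂ k μT hμadd₁ hμsmul₁ hμadd₂ hμsmul₂, fun _ _ => rfl⟩
  simp only [hμ] at hμT ⊢
  have hσ1 : σ 1 = 1 := by rw [hσ 0 1 Ω.one_mem, gsign_zero, one_smul]
  have hσe : σ e = e := by rw [hσ 0 e hι0, gsign_zero, one_smul]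
  have hσx : σ (Ω.d e) = -Ω.d e := by rw [DGAlg.parity_d hspan hσ, hσe]
  have hσm := DGAlg.parity_mul hspan hσ
  have hdTe : dT (e ⊗ₜ e) = Ω.d e ⊗ₜ e + e ⊗ₜ Ω.d e := by simp [dT, hσe]
  refine ⟨?_, fun Δ hΔ1 hΔm hΔe hΔd => ?_⟩
  · obtain ⟨F, hFe, hFx, hFd⟩ := DGAlg.exists_action hspan hσ ι hι0 huniv
    rw [← he] at hFe hFx
    have hFm : ∀ a z, F a z = μ (F a (1 ⊗ₜ 1)) z := fun a z => by
      refine DFunLike.congr_fun (DFunLike.congr_fun (LinearMap.ext_of_mul_left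
        (Φ := F.toLinearMap) (Ψ := μ ∘ₗ LinearMap.applyₗ (1 ⊗ₜ 1) ∘ₗ F.toLinearMap)
        hgen ?_ ?_) a) z
      · refine LinearMap.ext fun z => ?_
        have h := DGAlg.koszul_leftGrouplike hspan hμT Ω.one_mem z
        simp only [LinearMap.comp_apply, AlgHom.toLinearMap_apply, map_one,
          LinearMap.applyₗ_apply_apply, Module.End.one_apply]
        rw [h]
        exact DFunLike.congr_fun (f := LinearMap.id) (TensorProduct.ext' fun a b => by simp) z
      · rintro g hg y ih
        refine LinearMap.ext fun z => ?_
        have ih' : ∀ z, F y z = μ (F y (1 ⊗ₜ 1)) z := fun z => DFunLike.congr_fun ih z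
        simp only [LinearMap.comp_apply, AlgHom.toLinearMap_apply, map_mul,
          LinearMap.applyₗ_apply_apply, Module.End.mul_apply]
        rw [ih']
        rcases hg with rfl | rfl
        · rw [hFe, DGAlg.koszul_leftGrouplike_assoc hspan hμT hι0]
        · rw [hFx, DGAlg.koszul_leftPrimitive_assoc hspan hσ hμT hι0]
    refine ⟨LinearMap.applyₗ (1 ⊗ₜ 1) ∘ₗ F.toLinearMap, ⟨?_, ?_, ?_, ?_⟩, ?_⟩
    · simp
    · intro a b
      simp only [LinearMap.comp_apply, AlgHom.toLinearMap_apply, map_mul,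
        LinearMap.applyₗ_apply_apply, Module.End.mul_apply]
      exact hFm a _
    · simp [hFe]
    · exact hFd
    · rintro Δ ⟨hΔ1, hΔm, hΔe, hΔd⟩
      refine LinearMap.ext_of_mul_left hgen (by simp [hΔ1]) ?_
      rintro g hg y ih
      simp only [LinearMap.comp_apply, AlgHom.toLinearMap_apply, map_mul,
        LinearMap.applyₗ_apply_apply, Module.End.mul_apply] at ih ⊢
      rw [hΔm, ih]
      rcases hg with rfl | rfl
      · rw [hΔe, hFe, DGAlg.koszul_leftGrouplike hspan hμT hι0]
      · rw [hΔd, hΔe, hdTe, hFx, DGAlg.koszul_leftPrimitive hspan hσ hμT hι0]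
  · have hle : ∀ y, Δ (e * y) = leftGrouplike k e (Δ y) := fun y => by
      rw [hΔm, hΔe, DGAlg.koszul_leftGrouplike hspan hμT hι0]
    have hlx : ∀ y, Δ (Ω.d e * y) = leftPrimitive σ e (Ω.d e) (Δ y) := fun y => by
      rw [hΔm, hΔd, hΔe, hdTe, DGAlg.koszul_leftPrimitive hspan hσ hμT hι0]
    have hre : ∀ y, Δ (y * e) = rightGrouplike k e (Δ y) := fun y => by
      rw [hΔm, hΔe, DGAlg.koszul_rightGrouplike hspan hμT hι0]
    have hrx : ∀ y, Δ (y * Ω.d e) = rightPrimitive σ e (Ω.d e) (Δ y) := fun y => by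
      rw [hΔm, hΔd, hΔe, hdTe, DGAlg.koszul_rightPrimitive hspan hσ hμT hι0]
    refine ⟨comul_coassoc hgen (comul_parity hgen hσ1 hσm hσe hσx hΔ1 hle hlx) hΔ1 hle hlx, ?_,
      comul_mem_coidealSpan hgen hσm hσe hσx hΔ1 hle hlx hre hrx rfl⟩
    obtain ⟨ε, ⟨hεd, -, hει⟩, -⟩ : ∃! ε : Ω.carrier →ₐ[k] k, (∀ a, ε (Ω.d a) = 0) ∧
        (∀ i x, x ∈ Ω.grading i → ε x ∈ (groundDGAlg k).grading i) ∧
        ε.comp ι = AlgHom.fst k k k :=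
      huniv (groundDGAlg k) (AlgHom.fst k k k) trivial
    exact ⟨ε.toLinearMap, map_one ε, map_mul ε, comul_counit hgen hσ1 hσm hσe hσx hΔ1 hle hlx ε
      (DFunLike.congr_fun hει (1, 0)) (hεd e)⟩
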